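/- (Variance decay under two-stage construction, Lemma 3.1.) For every integer k ≥ 2, every p ∈ (0,1), every n > 0 and every axis-parallel rectangle R = [a,b] × [c,d] ⊆ S with a < b and c < d, one has Var( E[f_R(η) | η_k] ) ≤ 1/k, where η_k is distributed as P_{kn,p}, η is the 1/k-thinning of η_k, and the variance is taken under P_{kn,p}. -/

import Mathlib

open MeasureTheory ProbabilityTheory Set Filter
open scoped ENNReal

noncomputable section

abbrev Plane : Type := EuclideanSpace ℝ (Fin 2)
abbrev Pt : Type := Plane × Bool
abbrev Config : Type := Set Pt

/-- The unit square `S = [0,1]²`. -/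
def Sq : Set Plane := {x | x 0 ∈ Icc (0:ℝ) 1 ∧ x 1 ∈ Icc (0:ℝ) 1}

/-- The law of the mark of a point: `1` (blue) with probability `p`, `0` (red) otherwise. -/
def markLaw (p : ℝ) : Measure Bool :=
  p.toNNReal • Measure.dirac true + (1 - p).toNNReal • Measure.dirac false

/-- The law of a single point of the process: uniform location in `S`, independent mark. -/
def ptLaw (p : ℝ) : Measure Pt := (volume.restrict Sq).prod (markLaw p)

/-- Poisson probability mass function with parameter `r`. -/
def pois (r : ℝ) (N : ℕ) : ℝ := Real.exp (-r) * r ^ N / N.factorial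

/-- The configuration determined by a finite list of marked points. -/
def cfgOf {N : ℕ} (x : Fin N → Pt) : Config := Set.range x

/-- Expectation of `g` under the Poisson Voronoi law `P_{n,p}`. -/
def PE (n p : ℝ) (g : Config → ℝ) : ℝ :=
  ∑' N : ℕ, pois n N * ∫ x : Fin N → Pt, g (cfgOf x) ∂(Measure.pi fun _ => ptLaw p)

/-- `y ∈ S` is blue if it belongs to the Voronoi cell of a blue point of `η`. -/
def isBlue (η : Config) (y : Plane) : Prop :=
  ∃ q ∈ η, q.2 = true ∧ ∀ r ∈ η, dist y q.1 ≤ dist y r.1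

/-- The rectangle `[a,b] × [c,d]`. -/
def rect (a b c d : ℝ) : Set Plane := {x | x 0 ∈ Icc a b ∧ x 1 ∈ Icc c d}

/-- The horizontal blue crossing event `H_R` for `R = [a,b] × [c,d]`. -/
def Crossing (a b c d : ℝ) (η : Config) : Prop :=
  ∃ K : Set Plane, K ⊆ {y | y ∈ rect a b c d ∧ isBlue η y} ∧ IsConnected K ∧
    (∃ y ∈ K, y 0 = a) ∧ (∃ y ∈ K, y 0 = b)

open Classical in
/-- The indicator `f_R` of the crossing event. -/
def fR (a b c d : ℝ) (η : Config) : ℝ := if Crossing a b c d η then 1 else 0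

/-- Uniform measure on `[0,1]`. -/
def unif01 : Measure ℝ := volume.restrict (Icc (0:ℝ) 1)

/-- Joint expectation of `g (η, η(ε))` where `η ~ P_{n,p}` and `η(ε)` is the `ε`-perturbation
of `η`: each point of `η` is deleted independently with probability `ε` and an independent
process of law `P_{εn,p}` is added. -/
def PE2pert (n p ε : ℝ) (g : Config → Config → ℝ) : ℝ :=
  ∑' N : ℕ, ∑' M : ℕ, pois n N * pois (ε * n) M *
    ∫ x : Fin N → Pt, ∫ y : Fin M → Pt, ∫ u : Fin N → ℝ,
      g (cfgOf x) ({q | ∃ i, x i = q ∧ ε ≤ u i} ∪ cfgOf y)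
      ∂(Measure.pi fun _ => unif01) ∂(Measure.pi fun _ => ptLaw p)
      ∂(Measure.pi fun _ => ptLaw p)

open Classical in
/-- Conditional expectation, given the configuration `η`, of `f` applied to the `1/k`-thinning
of `η` (each point of `η` is kept independently with probability `1/k`). -/
def thinCE (k : ℝ) (f : Config → ℝ) (η : Config) : ℝ :=
  if h : η.Finite then
    ∑ A ∈ h.toFinset.powerset,
      (1/k) ^ A.card * (1 - 1/k) ^ (h.toFinset.card - A.card) * f ↑A
  else 0


/-- The part of the Voronoi cell of the blue point `x i` inside the rectangle, for a finite family
`x` of marked points; it is empty when `x i` is red. -/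
def blueCell {ι : Type*} (a b c d : ℝ) (x : ι → Pt) (i : ι) : Set Plane :=
  {y | y ∈ rect a b c d ∧ (x i).2 = true ∧ ∀ j, dist y (x i).1 ≤ dist y (x j).1}

lemma mem_blueCell {ι : Type*} {a b c d : ℝ} {x : ι → Pt} {i : ι} {y : Plane} :
    y ∈ blueCell a b c d x i ↔
      y ∈ rect a b c d ∧ (x i).2 = true ∧ ∀ j, dist y (x i).1 ≤ dist y (x j).1 :=
  Iff.rfl

lemma isClosed_rect (a b c d : ℝ) : IsClosed (rect a b c d) := by
  have h : rect a b c d = (fun y : Plane => y 0) ⁻¹' Icc a b ∩ (fun y : Plane => y 1) ⁻¹' Icc c d :=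
    rfl
  rw [h]
  exact (isClosed_Icc.preimage (by fun_prop)).inter (isClosed_Icc.preimage (by fun_prop))

lemma isCompact_rect (a b c d : ℝ) : IsCompact (rect a b c d) := by
  have h : IsCompact (univ.pi ![Icc a b, Icc c d]) :=
    isCompact_univ_pi fun i => by fin_cases i <;> exact isCompact_Icc
  convert ((EuclideanSpace.equiv (Fin 2) ℝ).toHomeomorph.isCompact_preimage).2 h using 1
  ext y
  simp [rect, Fin.forall_fin_two]

lemma convex_rect (a b c d : ℝ) : Convex ℝ (rect a b c d) := by
  have h : rect a b c d = (EuclideanSpace.proj 0 : Plane →L[ℝ] ℝ) ⁻¹' Icc a b ∩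
      (EuclideanSpace.proj 1 : Plane →L[ℝ] ℝ) ⁻¹' Icc c d := rfl
  rw [h]
  exact ((convex_Icc a b).linear_preimage
    (EuclideanSpace.proj 0 : Plane →L[ℝ] ℝ).toLinearMap).inter
    ((convex_Icc c d).linear_preimage
      (EuclideanSpace.proj 1 : Plane →L[ℝ] ℝ).toLinearMap)

lemma convex_setOf_dist_le_dist {E : Type*} [NormedAddCommGroup E] [InnerProductSpace ℝ E]
    (p q : E) : Convex ℝ {y : E | dist y p ≤ dist y q} := by
  have h : {y : E | dist y p ≤ dist y q} =
      {y | innerSL ℝ (q - p) y ≤ (‖q‖ ^ 2 - ‖p‖ ^ 2) / 2} := by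
    ext y
    simp only [mem_ofPred_eq, dist_eq_norm, innerSL_apply_apply]
    rw [← sq_le_sq₀ (norm_nonneg _) (norm_nonneg _), norm_sub_sq_real, norm_sub_sq_real,
      inner_sub_left, real_inner_comm q y, real_inner_comm p y]
    constructor <;> intro h <;> linarith
  rw [h]
  exact convex_halfSpace_le (innerSL ℝ (q - p)).toLinearMap.isLinear _

section BlueCell

variable {ι : Type*} (a b c d : ℝ)

lemma convex_blueCell (x : ι → Pt) (i : ι) : Convex ℝ (blueCell a b c d x i) := by
  by_cases hi : (x i).2 = true
  · have h : blueCell a b c d x i =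
        rect a b c d ∩ ⋂ j, {y | dist y (x i).1 ≤ dist y (x j).1} := by
      ext y
      simp [mem_blueCell, hi]
    rw [h]
    exact (convex_rect a b c d).inter (convex_iInter fun j => convex_setOf_dist_le_dist _ _)
  · have h : blueCell a b c d x i = ∅ := by
      ext y
      simp [mem_blueCell, hi]
    rw [h]
    exact convex_empty

lemma isClosed_setOf_mem_blueCell (i : ι) :
    IsClosed {z : (ι → Pt) × Plane | z.2 ∈ blueCell a b c d z.1 i} := by
  have h : {z : (ι → Pt) × Plane | z.2 ∈ blueCell a b c d z.1 i} =
      Prod.snd ⁻¹' rect a b c d ∩ ((fun z => (z.1 i).2) ⁻¹' {true} ∩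
        ⋂ j, {z | dist z.2 (z.1 i).1 ≤ dist z.2 (z.1 j).1}) := by
    ext z
    simp [mem_blueCell]
  rw [h]
  refine ((isClosed_rect a b c d).preimage continuous_snd).inter
    (((isClosed_discrete _).preimage (by fun_prop)).inter (isClosed_iInter fun j => ?_))
  exact isClosed_le (by fun_prop) (by fun_prop)

lemma isClosed_blueCell (x : ι → Pt) (i : ι) : IsClosed (blueCell a b c d x i) :=
  (isClosed_setOf_mem_blueCell a b c d i).preimage (Continuous.prodMk_right x)

lemma isClosed_setOf_exists_mem_of_isCompact {X Y : Type*} [TopologicalSpace X]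
    [TopologicalSpace Y] {K : Set Y} (hK : IsCompact K) {C : Set (X × Y)} (hC : IsClosed C) :
    IsClosed {x | ∃ y ∈ K, (x, y) ∈ C} := by
  have := isCompact_iff_compactSpace.1 hK
  have h := isClosedMap_fst_of_compactSpace (X := X) (Y := K) _
    (hC.preimage (f := fun z : X × K => (z.1, (z.2 : Y))) (by fun_prop))
  convert h using 1
  ext x
  simp

lemma isClosed_setOf_exists_mem_blueCell {T : Set ((ι → Pt) × Plane)} (hT : IsClosed T) (i : ι) :
    IsClosed {x | ∃ y ∈ blueCell a b c d x i, (x, y) ∈ T} := by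
  convert isClosed_setOf_exists_mem_of_isCompact (isCompact_rect a b c d)
    ((isClosed_setOf_mem_blueCell a b c d i).inter hT) using 1
  ext x
  refine exists_congr fun y => ⟨fun h => ⟨h.1.1, h.1, h.2⟩, fun h => ⟨h.2.1, h.2.2⟩⟩

lemma blueRegion_eq_iUnion_blueCell (x : ι → Pt) :
    {y | y ∈ rect a b c d ∧ isBlue (range x) y} = ⋃ i, blueCell a b c d x i := by
  ext y
  simp [mem_blueCell, isBlue]

/-- A blue crossing exists if and only if some chain of successively intersecting blue cells joins
the left side of the rectangle to the right side. -/
lemma crossing_range_iff [Finite ι] (x : ι → Pt) :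
    Crossing a b c d (range x) ↔ ∃ i j, (∃ y ∈ blueCell a b c d x i, y 0 = a) ∧
      (∃ y ∈ blueCell a b c d x j, y 0 = b) ∧
      Relation.ReflTransGen (fun i j => ∃ y ∈ blueCell a b c d x i, y ∈ blueCell a b c d x j)
        i j := by
  unfold Crossing
  rw [blueRegion_eq_iUnion_blueCell]
  constructor
  · rintro ⟨K, hK, hKc, ⟨y, hyK, hya⟩, ⟨z, hzK, hzb⟩⟩
    obtain ⟨i, hi⟩ := mem_iUnion.1 (hK hyK)
    set I : Set ι := {j | Relation.ReflTransGen
      (fun i j => ∃ y ∈ blueCell a b c d x i, y ∈ blueCell a b c d x j) i j} with hI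
    have hz : ∃ j ∈ I, z ∈ blueCell a b c d x j := by
      by_contra! hcon
      obtain ⟨j, hj⟩ := mem_iUnion.1 (hK hzK)
      have hjI : j ∉ I := fun h => hcon j h hj
      obtain ⟨w, -, hw1, hw2⟩ := isPreconnected_closed_iff.1 hKc.isPreconnected
        (⋃ j ∈ I, blueCell a b c d x j) (⋃ j ∈ Iᶜ, blueCell a b c d x j)
        (I.toFinite.isClosed_biUnion fun j _ => isClosed_blueCell a b c d x j)
        (Iᶜ.toFinite.isClosed_biUnion fun j _ => isClosed_blueCell a b c d x j)
        (fun w hw => by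
          obtain ⟨l, hl⟩ := mem_iUnion.1 (hK hw)
          by_cases hlI : l ∈ I
          · exact Or.inl (mem_biUnion hlI hl)
          · exact Or.inr (mem_biUnion hlI hl))
        ⟨y, hyK, mem_biUnion (Relation.ReflTransGen.refl : i ∈ I) hi⟩
        ⟨z, hzK, mem_biUnion hjI hj⟩
      obtain ⟨l, hlI, hl⟩ := mem_iUnion₂.1 hw1
      obtain ⟨m, hmI, hm⟩ := mem_iUnion₂.1 hw2
      exact hmI (Relation.ReflTransGen.tail hlI ⟨w, hl, hm⟩)
    obtain ⟨j, hj, hzj⟩ := hz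
    exact ⟨i, j, ⟨y, hi, hya⟩, ⟨z, hzj, hzb⟩, hj⟩
  · rintro ⟨i, j, ⟨y, hy, hya⟩, ⟨z, hz, hzb⟩, hij⟩
    suffices h : ∃ K : Set Plane, K ⊆ ⋃ i, blueCell a b c d x i ∧ IsPreconnected K ∧ y ∈ K ∧
        blueCell a b c d x j ⊆ K by
      obtain ⟨K, hK, hKc, hyK, hjK⟩ := h
      exact ⟨K, hK, ⟨⟨y, hyK⟩, hKc⟩, ⟨y, hyK, hya⟩, ⟨z, hjK hz, hzb⟩⟩
    clear hz hzb
    induction hij with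
    | refl => exact ⟨_, subset_iUnion _ i, (convex_blueCell a b c d x i).isPreconnected, hy, le_rfl⟩
    | @tail l m _ hlm ih =>
      obtain ⟨K, hK, hKc, hyK, hlK⟩ := ih
      obtain ⟨w, hwl, hwm⟩ := hlm
      exact ⟨K ∪ blueCell a b c d x m, union_subset hK (subset_iUnion _ m),
        hKc.union w (hlK hwl) hwm (convex_blueCell a b c d x m).isPreconnected,
        Or.inl hyK, subset_union_right⟩

lemma isClosed_setOf_crossing [Finite ι] :
    IsClosed {x : ι → Pt | Crossing a b c d (range x)} := by
  simp_rw [crossing_range_iff]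
  have h_side (e : ℝ) (i : ι) : IsClosed {x : ι → Pt | ∃ y ∈ blueCell a b c d x i, y 0 = e} :=
    isClosed_setOf_exists_mem_blueCell a b c d (T := {z | z.2 0 = e})
      (isClosed_eq (by fun_prop) continuous_const) i
  have h_adj (i j : ι) :
      IsClosed {x : ι → Pt | ∃ y ∈ blueCell a b c d x i, y ∈ blueCell a b c d x j} :=
    isClosed_setOf_exists_mem_blueCell a b c d (isClosed_setOf_mem_blueCell a b c d j) i
  have key {P : ι → (ι → Pt) → Prop} (hP : ∀ i, IsClosed {x | P i x}) (x₀ : ι → Pt) :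
      ∀ᶠ x in nhds x₀, ∀ i, P i x → P i x₀ := by
    refine eventually_all.2 fun i => ?_
    by_cases h : P i x₀
    · exact Eventually.of_forall fun _ _ => h
    · filter_upwards [(hP i).isOpen_compl.mem_nhds h] with x hx hx'
      exact absurd hx' hx
  rw [← isOpen_compl_iff, isOpen_iff_mem_nhds]
  intro x₀ hx₀
  filter_upwards [key (h_side a) x₀, key (h_side b) x₀,
    eventually_all.2 fun i => key (h_adj i) x₀] with x h1 h2 h3
  rintro ⟨i, j, hi, hj, hij⟩
  exact hx₀ ⟨i, j, h1 i hi, h2 j hj, Relation.ReflTransGen.mono (fun i j h => h3 i j h) _ _ hij⟩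

lemma measurable_fR_range [Finite ι] : Measurable fun x : ι → Pt => fR a b c d (range x) := by
  have := Fintype.ofFinite ι
  unfold fR
  exact Measurable.ite (isClosed_setOf_crossing a b c d).measurableSet measurable_const
    measurable_const

end BlueCell

section Colourings

variable {ι : Type*} [Fintype ι] [DecidableEq ι]

/-- The `q`-thinning average of a function of subsets of a finite type. -/
def thinSum (q : ℝ) (F : Finset ι → ℝ) : ℝ :=
  ∑ A, q ^ A.card * (1 - q) ^ (Fintype.card ι - A.card) * F A

/-- The average of `F A * F B` where each point independently joins `A` with probability `q`,
`B` with probability `q`, and neither otherwise. -/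
def pairSum (q : ℝ) (F : Finset ι → ℝ) : ℝ :=
  ∑ A, ∑ B ∈ Aᶜ.powerset,
    q ^ A.card * (q ^ B.card * (1 - 2 * q) ^ (Aᶜ.card - B.card)) * (F A * F B)

lemma card_filter_colourClass_eq (k : ℕ) (i : Fin k) (A : Finset ι) :
    (Finset.univ.filter fun c : ι → Fin k => Finset.univ.filter (fun x => c x = i) = A).card =
      (k - 1) ^ Aᶜ.card := by
  have h : (Finset.univ.filter fun c : ι → Fin k => Finset.univ.filter (fun x => c x = i) = A) =
      Fintype.piFinset fun x => if x ∈ A then {i} else {i}ᶜ := by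
    ext c
    simp only [Finset.mem_filter, Finset.mem_univ, true_and, Fintype.mem_piFinset, Finset.ext_iff]
    refine forall_congr' fun x => ?_
    by_cases hx : x ∈ A <;> simp [hx]
  rw [h, Fintype.card_piFinset, ← Finset.prod_mul_prod_compl A,
    Finset.prod_congr rfl (g := fun _ => 1) fun x hx => by simp [hx],
    Finset.prod_congr (s₁ := Aᶜ) rfl (g := fun _ => k - 1) fun x hx => by
      simp [Finset.mem_compl.1 hx, Finset.card_compl]]
  simp

lemma card_filter_colourClass_eq_and (k : ℕ) {i j : Fin k} (hij : i ≠ j) {A B : Finset ι}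
    (hAB : B ⊆ Aᶜ) :
    (Finset.univ.filter fun c : ι → Fin k => Finset.univ.filter (fun x => c x = i) = A ∧
      Finset.univ.filter (fun x => c x = j) = B).card = (k - 2) ^ (Aᶜ.card - B.card) := by
  have hBA : ∀ x ∈ B, x ∉ A := fun x hx => Finset.mem_compl.1 (hAB hx)
  have h : (Finset.univ.filter fun c : ι → Fin k => Finset.univ.filter (fun x => c x = i) = A ∧
      Finset.univ.filter (fun x => c x = j) = B) =
      Fintype.piFinset fun x => if x ∈ A then {i} else if x ∈ B then {j} else {i, j}ᶜ := by
    ext c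
    simp only [Finset.mem_filter, Finset.mem_univ, true_and, Fintype.mem_piFinset, Finset.ext_iff,
      ← forall_and]
    refine forall_congr' fun x => ?_
    have := hBA x
    by_cases hx : x ∈ A <;> by_cases hx' : x ∈ B <;> simp_all <;> grind
  rw [h, Fintype.card_piFinset, ← Finset.prod_mul_prod_compl A,
    Finset.prod_congr rfl (g := fun _ => 1) fun x hx => by simp [hx],
    ← Finset.prod_sdiff hAB,
    Finset.prod_congr (s₁ := Aᶜ \ B) rfl (g := fun _ => k - 2) fun x hx => by
      obtain ⟨h1, h2⟩ := Finset.mem_sdiff.1 hx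
      rw [if_neg (Finset.mem_compl.1 h1), if_neg h2, Finset.card_compl, Finset.card_pair hij,
        Fintype.card_fin],
    Finset.prod_congr (s₁ := B) rfl (g := fun _ => 1) fun x hx => by simp [hx, hBA x hx]]
  simp [Finset.card_sdiff_of_subset hAB]

lemma sum_colourClass (k : ℕ) (hk : 2 ≤ k) (i : Fin k) (F : Finset ι → ℝ) :
    ∑ c : ι → Fin k, F (Finset.univ.filter fun x => c x = i) =
      k ^ Fintype.card ι * thinSum (1 / k) F := by
  have hk0 : (k : ℝ) ≠ 0 := by positivity
  rw [← Finset.sum_fiberwise Finset.univ fun c : ι → Fin k => Finset.univ.filter fun x => c x = i]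
  rw [thinSum, Finset.mul_sum]
  refine Finset.sum_congr rfl fun A _ => ?_
  rw [Finset.sum_congr rfl (g := fun _ => F A) fun c hc => by rw [(Finset.mem_filter.1 hc).2],
    Finset.sum_const, card_filter_colourClass_eq, nsmul_eq_mul, Finset.card_compl]
  have hcard : Fintype.card ι = A.card + (Fintype.card ι - A.card) := by
    have := A.card_le_univ
    omega
  have h1 : (1 : ℝ) - 1 / k = ((k - 1 : ℕ) : ℝ) / k := by
    rw [Nat.cast_sub (by omega)]
    field_simp
    simp
  rw [h1, div_pow, div_pow]
  nth_rw 2 [hcard]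
  rw [pow_add]
  push_cast
  field_simp
  simp

lemma sum_colourClass_mul (k : ℕ) (hk : 2 ≤ k) {i j : Fin k} (hij : i ≠ j) (F : Finset ι → ℝ) :
    ∑ c : ι → Fin k, F (Finset.univ.filter fun x => c x = i) *
        F (Finset.univ.filter fun x => c x = j) =
      k ^ Fintype.card ι * pairSum (1 / k) F := by
  have hk0 : (k : ℝ) ≠ 0 := by positivity
  rw [← Finset.sum_fiberwise Finset.univ fun c : ι → Fin k => Finset.univ.filter fun x => c x = i]
  rw [pairSum, Finset.mul_sum]
  refine Finset.sum_congr rfl fun A _ => ?_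
  have hmaps : ∀ c ∈ Finset.univ.filter fun c : ι → Fin k =>
      Finset.univ.filter (fun x => c x = i) = A,
      Finset.univ.filter (fun x => c x = j) ∈ Aᶜ.powerset := by
    intro c hc
    rw [Finset.mem_powerset, ← (Finset.mem_filter.1 hc).2]
    intro x hx
    simp only [Finset.mem_filter, Finset.mem_univ, true_and, Finset.mem_compl] at hx ⊢
    rw [hx]
    exact hij.symm
  rw [← Finset.sum_fiberwise_of_maps_to hmaps, Finset.mul_sum]
  refine Finset.sum_congr rfl fun B hB => ?_
  rw [Finset.mem_powerset] at hB
  rw [Finset.sum_congr rfl (g := fun _ => F A * F B) fun c hc => by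
      rw [(Finset.mem_filter.1 (Finset.mem_filter.1 hc).1).2, (Finset.mem_filter.1 hc).2],
    Finset.sum_const, Finset.filter_filter, card_filter_colourClass_eq_and k hij hB, nsmul_eq_mul]
  have hcard : Fintype.card ι = A.card + (B.card + (Aᶜ.card - B.card)) := by
    have := Finset.card_le_card hB
    have := A.card_compl_add_card
    omega
  have h1 : (1 : ℝ) - 2 * (1 / k) = ((k - 2 : ℕ) : ℝ) / k := by
    rw [Nat.cast_sub (by omega)]
    field_simp
    simp
  rw [h1, div_pow, div_pow, div_pow, hcard, pow_add, pow_add]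
  push_cast
  field_simp
  simp

/-- Jensen's inequality for the average of an indicator over the colour classes of a uniform
colouring with `k` colours. -/
lemma sq_thinSum_le (k : ℕ) (hk : 2 ≤ k) (F : Finset ι → ℝ) (hF : ∀ A, F A * F A = F A) :
    thinSum (1 / k : ℝ) F ^ 2 ≤
      1 / k * thinSum (1 / k : ℝ) F + (1 - 1 / k) * pairSum (1 / k : ℝ) F := by
  have hk0 : (0 : ℝ) < k := by positivity
  set W : ℝ := (k : ℝ) ^ Fintype.card ι with hW
  have hW0 : 0 < W := by positivity
  set t := thinSum (1 / k : ℝ) F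
  set s := pairSum (1 / k : ℝ) F
  let f : (ι → Fin k) → Fin k → ℝ := fun c i => F (Finset.univ.filter fun x => c x = i)
  have h1 : ∑ c, ∑ i, f c i = k * (W * t) := by
    rw [Finset.sum_comm, Finset.sum_congr rfl fun i _ => sum_colourClass k hk i F,
      Finset.sum_const, Finset.card_univ, Fintype.card_fin, nsmul_eq_mul]
  have h2 : ∑ c, (∑ i, f c i) ^ 2 = k * (W * t + (k - 1) * (W * s)) := by
    simp_rw [sq, Finset.sum_mul_sum]
    rw [Finset.sum_comm]
    have h : ∀ i : Fin k, ∑ c, ∑ j, f c i * f c j = W * t + (k - 1) * (W * s) := by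
      intro i
      rw [Finset.sum_comm, ← Finset.add_sum_erase _ _ (Finset.mem_univ i),
        Finset.sum_congr rfl fun j hj =>
          sum_colourClass_mul k hk (Finset.ne_of_mem_erase hj).symm F]
      simp only [f, hF]
      rw [sum_colourClass k hk i F, Finset.sum_const, Finset.card_erase_of_mem (Finset.mem_univ i),
        Finset.card_univ, Fintype.card_fin, nsmul_eq_mul, Nat.cast_sub (by omega)]
      simp [t, s, W]
    rw [Finset.sum_congr rfl fun i _ => h i, Finset.sum_const, Finset.card_univ, Fintype.card_fin,
      nsmul_eq_mul]
  have h3 := sq_sum_le_card_mul_sum_sq (s := (Finset.univ : Finset (ι → Fin k)))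
    (f := fun c => ∑ i, f c i)
  rw [h1, h2, Finset.card_univ, Fintype.card_fun, Fintype.card_fin, Nat.cast_pow, ← hW] at h3
  have h4 : (k * W) ^ 2 * t ^ 2 ≤ (k * W) ^ 2 * (1 / k * t + (1 - 1 / k) * s) := by
    calc (k * W) ^ 2 * t ^ 2 = (k * (W * t)) ^ 2 := by ring
      _ ≤ _ := h3
      _ = _ := by field_simp
  exact le_of_mul_le_mul_left h4 (by positivity)

end Colourings

lemma sum_finset_card_eq {ι : Type*} [Fintype ι] (G : ℕ → ℝ) :
    ∑ A : Finset ι, G A.card =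
      ∑ m ∈ Finset.range (Fintype.card ι + 1), (Fintype.card ι).choose m * G m := by
  rw [← Finset.powerset_univ, Finset.sum_powerset_apply_card]
  simp [Finset.card_univ]

lemma summable_pois_mul (r : ℝ) {α : ℕ → ℝ} (hα : ∀ m, |α m| ≤ 1) :
    Summable fun m => ‖pois r m * α m‖ := by
  have h : Summable fun m => ‖pois r m‖ := by
    unfold pois
    simp_rw [mul_div_assoc, norm_mul]
    exact (Real.summable_pow_div_factorial r).norm.mul_left _
  refine Summable.of_nonneg_of_le (fun _ => norm_nonneg _) (fun m => ?_) h
  rw [norm_mul]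
  exact mul_le_of_le_one_right (norm_nonneg _) (hα m)

lemma tsum_pois (r : ℝ) : ∑' m, pois r m = 1 := by
  unfold pois
  simp_rw [mul_div_assoc]
  rw [tsum_mul_left, ← congrFun (NormedSpace.exp_eq_tsum_div (𝔸 := ℝ)) r, ← Real.exp_eq_exp_ℝ, ← Real.exp_add]
  simp

/-- Poisson splitting, for a binomial-type convolution with weights `q` and `r` that need not sum
to one. -/
lemma hasSum_pois_mul_binomial (t q r : ℝ) {α β : ℕ → ℝ} (hα : ∀ m, |α m| ≤ 1)
    (hβ : ∀ m, |β m| ≤ 1) :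
    HasSum (fun N => pois t N * ∑ m ∈ Finset.range (N + 1),
        N.choose m * (q ^ m * r ^ (N - m) * (α m * β (N - m))))
      (Real.exp (t * (q + r - 1)) *
        ((∑' m, pois (q * t) m * α m) * ∑' m, pois (r * t) m * β m)) := by
  have h1 := summable_pois_mul (q * t) hα
  have h2 := summable_pois_mul (r * t) hβ
  rw [tsum_mul_tsum_eq_tsum_sum_range_of_summable_norm h1 h2]
  refine Eq.subst (motive := fun g => HasSum g _) (funext fun N => ?_)
    ((summable_norm_sum_mul_range_of_summable_norm h1 h2).of_norm.hasSum.mul_left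
      (Real.exp (t * (q + r - 1))))
  rw [Finset.mul_sum, Finset.mul_sum]
  refine Finset.sum_congr rfl fun m hm => ?_
  have hm : m ≤ N := Nat.lt_succ_iff.1 (Finset.mem_range.1 hm)
  unfold pois
  rw [Nat.cast_choose ℝ hm, mul_pow, mul_pow]
  have h3 : Real.exp (-t) =
      Real.exp (t * (q + r - 1)) * Real.exp (-(q * t)) * Real.exp (-(r * t)) := by
    rw [← Real.exp_add, ← Real.exp_add]
    ring_nf
  have h4 : t ^ N = t ^ m * t ^ (N - m) := by rw [← pow_add, Nat.add_sub_cancel' hm]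
  rw [h3, h4]
  have := Nat.factorial_ne_zero N
  field_simp

instance isProbabilityMeasure_ptLaw (p : Icc (0 : ℝ) 1) : IsProbabilityMeasure (ptLaw p) := by
  have h1 : volume Sq = 1 := by
    have h : Sq = WithLp.ofLp ⁻¹' (univ.pi fun _ : Fin 2 => Icc (0 : ℝ) 1) := by
      ext y
      simp [Sq, Pi.le_def, Fin.forall_fin_two]
      tauto
    rw [h, (PiLp.volume_preserving_ofLp (Fin 2)).measure_preimage
      (MeasurableSet.univ_pi fun _ => measurableSet_Icc).nullMeasurableSet, volume_pi_pi]
    simp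
  have : IsProbabilityMeasure (volume.restrict Sq) := ⟨by simp [h1]⟩
  have : IsProbabilityMeasure (markLaw p) := by
    refine ⟨?_⟩
    obtain ⟨p, hp0, hp1⟩ := p
    have h : p.toNNReal + (1 - p).toNNReal = 1 := by
      rw [← Real.toNNReal_add hp0 (by linarith)]
      simp
    simp only [markLaw, Measure.coe_add, Pi.add_apply, Measure.smul_apply, measure_univ]
    simp only [ENNReal.smul_def, smul_eq_mul, mul_one]
    exact_mod_cast h
  unfold ptLaw
  infer_instance

instance nullSingletonClass_ptLaw (p : Icc (0 : ℝ) 1) : NullSingletonClass (ptLaw p) := by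
  unfold ptLaw markLaw
  infer_instance

lemma iIndepFun_eval_pi {ι X : Type*} [Fintype ι] [MeasurableSpace X] (μ : Measure X)
    [IsProbabilityMeasure μ] :
    iIndepFun (fun (i : ι) (x : ι → X) => x i) (Measure.pi fun _ => μ) :=
  iIndepFun_pi (μ := fun _ : ι => μ) (X := fun _ => id) fun _ => aemeasurable_id

lemma map_pi_comp_of_injective {ι κ X : Type*} [Fintype ι] [Fintype κ] [MeasurableSpace X]
    (μ : Measure X) [IsProbabilityMeasure μ] {e : ι → κ} (he : Function.Injective e) :
    (Measure.pi fun _ : κ => μ).map (fun x i => x (e i)) = Measure.pi fun _ => μ := by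
  have h := (iIndepFun_eval_pi (ι := κ) μ).precomp he
  rw [iIndepFun_iff_map_fun_eq_pi_map fun i => (measurable_pi_apply (e i)).aemeasurable] at h
  refine h.trans (congrArg Measure.pi (funext fun i => ?_))
  exact (measurePreserving_eval (fun _ : κ => μ) (e i)).map_eq

lemma ae_injective_pi {ι X : Type*} [Fintype ι] [MeasurableSpace X] [MeasurableEq X]
    (μ : Measure X) [IsProbabilityMeasure μ] [NullSingletonClass μ] :
    ∀ᵐ x ∂(Measure.pi fun _ : ι => μ), Function.Injective x := by
  have h (i j : ι) (hij : i ≠ j) : ∀ᵐ x ∂(Measure.pi fun _ : ι => μ), x i ≠ x j := by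
    have hind := (iIndepFun_eval_pi (ι := ι) μ).indepFun hij
    rw [indepFun_iff_map_prod_eq_prod_map_map (measurable_pi_apply i).aemeasurable
      (measurable_pi_apply j).aemeasurable] at hind
    have hi (i : ι) : (Measure.pi fun _ : ι => μ).map (fun x => x i) = μ :=
      (measurePreserving_eval (fun _ : ι => μ) i).map_eq
    rw [hi, hi] at hind
    have hdiag : μ.prod μ (diagonal X) = 0 := by
      refine Measure.measure_prod_null_of_ae_null measurableSet_diagonal
        (Eventually.of_forall fun x => ?_)
      have : Prod.mk x ⁻¹' diagonal X = {x} := by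
        ext y
        simp [eq_comm]
      simp [this]
    rw [← hind, Measure.map_apply (by fun_prop) measurableSet_diagonal] at hdiag
    exact measure_eq_zero_iff_ae_notMem.1 hdiag
  have h' : ∀ᵐ x ∂(Measure.pi fun _ : ι => μ), ∀ i j, i ≠ j → x i ≠ x j :=
    ae_all_iff.2 fun i => ae_all_iff.2 fun j => by
      by_cases hij : i = j
      · exact Eventually.of_forall fun x hne => absurd hij hne
      · filter_upwards [h i j hij] with x hx _ using hx
  filter_upwards [h'] with x hx i j hij
  by_contra hne
  exact hx i j hne hij

lemma fR_mem_Icc (a b c d : ℝ) (η : Config) : fR a b c d η ∈ Icc (0 : ℝ) 1 := by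
  unfold fR
  split_ifs <;> simp

lemma fR_mul_self (a b c d : ℝ) (η : Config) : fR a b c d η * fR a b c d η = fR a b c d η := by
  unfold fR
  split_ifs <;> simp

lemma abs_fR_le_one (a b c d : ℝ) (η : Config) : |fR a b c d η| ≤ 1 := by
  have := fR_mem_Icc a b c d η
  rw [abs_of_nonneg this.1]
  exact this.2

/-- The thinning average of `f` over an injective finite list of points is a sum over sets of
indices. -/
lemma thinCE_cfgOf {N : ℕ} (q : ℝ) (f : Config → ℝ) {x : Fin N → Pt} (hx : Function.Injective x) :
    thinCE q f (cfgOf x) = thinSum (1 / q) fun A : Finset (Fin N) => f (range fun i : A => x i) := by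
  classical
  have hfin : (cfgOf x).Finite := finite_range x
  have hset : hfin.toFinset = Finset.univ.map ⟨x, hx⟩ := by
    ext y
    simp [cfgOf]
  rw [thinCE, dif_pos hfin, thinSum]
  symm
  refine Finset.sum_nbij (fun A => A.map ⟨x, hx⟩) (fun A _ => ?_)
    (Finset.map_injective _).injOn (fun B hB => ?_) (fun A _ => ?_)
  · rw [hset, Finset.mem_powerset]
    exact Finset.map_subset_map.2 (Finset.subset_univ A)
  · rw [Finset.mem_coe, hset, Finset.mem_powerset, Finset.subset_map_iff] at hB
    obtain ⟨A, -, rfl⟩ := hB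
    exact ⟨A, by simp, rfl⟩
  · have hcoe : (↑(A.map ⟨x, hx⟩) : Set Pt) = range fun i : A => x i := by
      ext y
      simp
    rw [hcoe, hset, Finset.card_map, Finset.card_map, Finset.card_univ]

section Crossing

variable (a b c d : ℝ) (p : Icc (0 : ℝ) 1)

/-- The probability of a blue crossing for `m` independent uniform marked points. -/
def crossProb (m : ℕ) : ℝ :=
  ∫ y : Fin m → Pt, fR a b c d (range y) ∂(Measure.pi fun _ => ptLaw p)

/-- The crossing indicator as a function of a set of indices of points. -/
def subF {N : ℕ} (x : Fin N → Pt) (A : Finset (Fin N)) : ℝ := fR a b c d (range fun i : A => x i)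

lemma measurable_subF {N : ℕ} (A : Finset (Fin N)) :
    Measurable fun x : Fin N → Pt => subF a b c d x A :=
  (measurable_fR_range a b c d).comp (g := fun y : A → Pt => fR a b c d (range y))
    (f := fun (x : Fin N → Pt) (i : A) => x i) (by fun_prop)

lemma abs_crossProb_le_one (m : ℕ) : |crossProb a b c d p m| ≤ 1 := by
  have h := norm_integral_le_of_norm_le_const (μ := Measure.pi fun _ : Fin m => ptLaw p)
    (f := fun y => fR a b c d (range y)) (C := 1)
    (Eventually.of_forall fun y => abs_fR_le_one a b c d _)
  simpa [crossProb] using h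

lemma integral_subF {N : ℕ} (A : Finset (Fin N)) :
    ∫ x : Fin N → Pt, subF a b c d x A ∂(Measure.pi fun _ => ptLaw p) =
      crossProb a b c d p A.card := by
  have he : Function.Injective (A.orderEmbOfFin rfl) := (A.orderEmbOfFin rfl).injective
  rw [crossProb, ← map_pi_comp_of_injective (ptLaw p) he,
    integral_map (measurable_pi_lambda _ fun i => measurable_pi_apply _).aemeasurable
      (measurable_fR_range a b c d).aestronglyMeasurable]
  refine integral_congr_ae (Eventually.of_forall fun x => ?_)
  have h : (range fun i : A => x i) = range fun i => x (A.orderEmbOfFin rfl i) := by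
    exact (image_eq_range x A).symm.trans
      (by rw [← A.range_orderEmbOfFin rfl, ← range_comp]; rfl)
  exact congrArg (fR a b c d) h

lemma integral_subF_mul {N : ℕ} {A B : Finset (Fin N)} (hAB : Disjoint A B) :
    ∫ x : Fin N → Pt, subF a b c d x A * subF a b c d x B ∂(Measure.pi fun _ => ptLaw p) =
      crossProb a b c d p A.card * crossProb a b c d p B.card := by
  have hind := (iIndepFun_eval_pi (ι := Fin N) (ptLaw p)).indepFun_finset A B hAB
    fun i => measurable_pi_apply i
  rw [← integral_subF, ← integral_subF]
  exact hind.integral_fun_comp_mul_comp (f := fun y => fR a b c d (range y))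
    (g := fun y => fR a b c d (range y))
    (measurable_pi_lambda _ fun i => measurable_pi_apply _).aemeasurable
    (measurable_pi_lambda _ fun i => measurable_pi_apply _).aemeasurable
    (measurable_fR_range a b c d).aestronglyMeasurable
    (measurable_fR_range a b c d).aestronglyMeasurable

lemma integrable_subF {N : ℕ} (A : Finset (Fin N)) :
    Integrable (fun x : Fin N → Pt => subF a b c d x A) (Measure.pi fun _ => ptLaw p) :=
  Integrable.of_bound (measurable_subF a b c d A).aestronglyMeasurable 1
    (Eventually.of_forall fun _ => abs_fR_le_one a b c d _)

lemma integrable_subF_mul {N : ℕ} (A B : Finset (Fin N)) :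
    Integrable (fun x : Fin N → Pt => subF a b c d x A * subF a b c d x B)
      (Measure.pi fun _ => ptLaw p) :=
  (integrable_subF a b c d p B).bdd_mul (c := 1) (measurable_subF a b c d A).aestronglyMeasurable
    (Eventually.of_forall fun _ => abs_fR_le_one a b c d _)

lemma integrable_thinSum_subF {N : ℕ} (q : ℝ) :
    Integrable (fun x : Fin N → Pt => thinSum q (subF a b c d x))
      (Measure.pi fun _ => ptLaw p) :=
  integrable_finsetSum _ fun A _ => (integrable_subF a b c d p A).const_mul _

lemma integrable_pairSum_subF {N : ℕ} (q : ℝ) :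
    Integrable (fun x : Fin N → Pt => pairSum q (subF a b c d x))
      (Measure.pi fun _ => ptLaw p) :=
  integrable_finsetSum _ fun A _ => integrable_finsetSum _ fun B _ =>
    (integrable_subF_mul a b c d p A B).const_mul _

lemma integrable_thinSum_subF_sq {N : ℕ} (q : ℝ) :
    Integrable (fun x : Fin N → Pt => thinSum q (subF a b c d x) ^ 2)
      (Measure.pi fun _ => ptLaw p) := by
  simp_rw [thinSum, sq, Finset.sum_mul_sum]
  refine integrable_finsetSum _ fun A _ => integrable_finsetSum _ fun B _ => ?_
  refine ((integrable_subF_mul a b c d p A B).const_mul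
    (q ^ A.card * (1 - q) ^ (Fintype.card (Fin N) - A.card) *
      (q ^ B.card * (1 - q) ^ (Fintype.card (Fin N) - B.card)))).congr
    (Eventually.of_forall fun x => ?_)
  exact mul_mul_mul_comm _ _ _ _

lemma integral_thinSum_subF (N : ℕ) (q : ℝ) :
    ∫ x : Fin N → Pt, thinSum q (subF a b c d x) ∂(Measure.pi fun _ => ptLaw p) =
      ∑ m ∈ Finset.range (N + 1),
        N.choose m * (q ^ m * (1 - q) ^ (N - m) * crossProb a b c d p m) := by
  unfold thinSum
  rw [integral_finsetSum _ fun A _ => (integrable_subF a b c d p A).const_mul _]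
  simp_rw [integral_const_mul, integral_subF]
  simpa using sum_finset_card_eq (ι := Fin N)
    fun m => q ^ m * (1 - q) ^ (N - m) * crossProb a b c d p m

lemma integral_pairSum_subF (N : ℕ) (q : ℝ) :
    ∫ x : Fin N → Pt, pairSum q (subF a b c d x) ∂(Measure.pi fun _ => ptLaw p) =
      ∑ m ∈ Finset.range (N + 1), N.choose m * (q ^ m * (crossProb a b c d p m *
        ∑ l ∈ Finset.range (N - m + 1), (N - m).choose l *
          (q ^ l * (1 - 2 * q) ^ (N - m - l) * crossProb a b c d p l))) := by
  unfold pairSum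
  rw [integral_finsetSum _ fun A _ => integrable_finsetSum _ fun B _ =>
    (integrable_subF_mul a b c d p A B).const_mul _]
  have h (A : Finset (Fin N)) :
      ∫ x : Fin N → Pt, (∑ B ∈ Aᶜ.powerset,
        q ^ A.card * (q ^ B.card * (1 - 2 * q) ^ (Aᶜ.card - B.card)) *
          (subF a b c d x A * subF a b c d x B)) ∂(Measure.pi fun _ => ptLaw p) =
      q ^ A.card * (crossProb a b c d p A.card * ∑ l ∈ Finset.range (N - A.card + 1),
        (N - A.card).choose l *
          (q ^ l * (1 - 2 * q) ^ (N - A.card - l) * crossProb a b c d p l)) := by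
    rw [integral_finsetSum _ fun B _ => (integrable_subF_mul a b c d p A B).const_mul _]
    have hc : Aᶜ.card = N - A.card := by rw [Finset.card_compl, Fintype.card_fin]
    have hs := Finset.sum_powerset_apply_card (x := Aᶜ) fun l =>
      q ^ l * (1 - 2 * q) ^ (N - A.card - l) * crossProb a b c d p l
    simp only [hc, nsmul_eq_mul] at hs
    rw [← hs, Finset.mul_sum, Finset.mul_sum]
    refine Finset.sum_congr rfl fun B hB => ?_
    rw [integral_const_mul, integral_subF_mul a b c d p
      (Finset.subset_compl_iff_disjoint_left.1 (Finset.mem_powerset.1 hB)), hc]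
    ring
  rw [Finset.sum_congr rfl fun A _ => h A]
  simpa using sum_finset_card_eq (ι := Fin N) fun m => q ^ m * (crossProb a b c d p m *
    ∑ l ∈ Finset.range (N - m + 1),
      (N - m).choose l * (q ^ l * (1 - 2 * q) ^ (N - m - l) * crossProb a b c d p l))

/-- Poisson thinning: the mean of the thinning average under intensity `t` is the crossing
probability under intensity `q * t`. -/
lemma hasSum_pois_mul_integral_thinSum (t q : ℝ) :
    HasSum (fun N => pois t N *
        ∫ x : Fin N → Pt, thinSum q (subF a b c d x) ∂(Measure.pi fun _ => ptLaw p))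
      (∑' m, pois (q * t) m * crossProb a b c d p m) := by
  have h := hasSum_pois_mul_binomial t q (1 - q) (abs_crossProb_le_one a b c d p)
    (β := fun _ => 1) (by simp)
  simp only [mul_one, tsum_pois, add_sub_cancel, sub_self, mul_zero, Real.exp_zero, one_mul,
    ← mul_assoc] at h
  simpa only [integral_thinSum_subF, ← mul_assoc] using h

/-- Poisson splitting: two disjoint thinnings of a Poisson process are independent. -/
lemma hasSum_pois_mul_integral_pairSum (t q : ℝ) (hq0 : 0 ≤ q) (hq : 2 * q ≤ 1) :
    HasSum (fun N => pois t N *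
        ∫ x : Fin N → Pt, pairSum q (subF a b c d x) ∂(Measure.pi fun _ => ptLaw p))
      ((∑' m, pois (q * t) m * crossProb a b c d p m) ^ 2) := by
  set χ : ℕ → ℝ := fun M => ∑ l ∈ Finset.range (M + 1),
    M.choose l * (q ^ l * (1 - 2 * q) ^ (M - l) * crossProb a b c d p l) with hχ
  have hχ1 (M : ℕ) : |χ M| ≤ 1 := by
    calc |χ M| ≤ ∑ l ∈ Finset.range (M + 1), q ^ l * (1 - 2 * q) ^ (M - l) * M.choose l := by
          refine (Finset.abs_sum_le_sum_abs _ _).trans (Finset.sum_le_sum fun l _ => ?_)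
          have h0 : 0 ≤ q ^ l * (1 - 2 * q) ^ (M - l) :=
            mul_nonneg (pow_nonneg hq0 _) (pow_nonneg (by linarith) _)
          rw [abs_mul, abs_mul, abs_of_nonneg h0, Nat.abs_cast, mul_comm (M.choose l : ℝ)]
          exact mul_le_mul_of_nonneg_right
            (mul_le_of_le_one_right h0 (abs_crossProb_le_one a b c d p l)) (Nat.cast_nonneg _)
      _ = (q + (1 - 2 * q)) ^ M := (add_pow _ _ _).symm
      _ ≤ 1 := pow_le_one₀ (by linarith) (by linarith)
  have h1 := (hasSum_pois_mul_binomial t q (1 - 2 * q) (abs_crossProb_le_one a b c d p)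
    (β := fun _ => 1) (by simp)).tsum_eq
  have h2 := hasSum_pois_mul_binomial t q 1 (abs_crossProb_le_one a b c d p) hχ1
  simp only [mul_one, tsum_pois, one_pow, one_mul] at h1 h2
  simp only [← mul_assoc] at h1
  simp only [hχ, ← mul_assoc] at h2
  rw [h1] at h2
  have hexp : Real.exp (t * (q + 1 - 1)) * Real.exp (t * (q + (1 - 2 * q) - 1)) = 1 := by
    rw [← Real.exp_add]
    simp
    ring
  simp only [integral_pairSum_subF, ← mul_assoc]
  convert h2 using 1
  linear_combination (-(∑' m, pois (q * t) m * crossProb a b c d p m) ^ 2) * hexp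

end Crossing

/-- **Lemma 3.1.** In the two-stage construction, where `η_k ~ P_{kn,p}` and `η` is the
`1/k`-thinning of `η_k`, the variance of `E[f_R(η) | η_k]` is at most `1/k`. -/
theorem variance_decay_two_stage
    (k : ℕ) (hk : 2 ≤ k) (p : ℝ) (hp : p ∈ Set.Ioo (0:ℝ) 1) (n : ℝ) (hn : 0 < n)
    (a b c d : ℝ) (ha : 0 ≤ a) (hab : a < b) (hb : b ≤ 1)
    (hc : 0 ≤ c) (hcd : c < d) (hd : d ≤ 1) :
    PE ((k : ℝ) * n) p (fun η => (thinCE k (fR a b c d) η) ^ 2)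
        - (PE ((k : ℝ) * n) p (thinCE k (fR a b c d))) ^ 2
      ≤ 1 / k := by
  obtain ⟨p, rfl⟩ : ∃ p' : Icc (0 : ℝ) 1, (p' : ℝ) = p := ⟨⟨p, hp.1.le, hp.2.le⟩, rfl⟩
  have hk2 : (2 : ℝ) ≤ k := by exact_mod_cast hk
  have hq0 : (0 : ℝ) < 1 / k := by positivity
  have hq : 2 * (1 / k : ℝ) ≤ 1 := by
    rw [mul_one_div, div_le_one (by linarith)]
    exact hk2
  have hthin (N : ℕ) : ∀ᵐ x ∂(Measure.pi fun _ : Fin N => ptLaw p),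
      thinCE k (fR a b c d) (cfgOf x) = thinSum (1 / k) (subF a b c d x) := by
    filter_upwards [ae_injective_pi (ι := Fin N) (ptLaw p)] with x hx
    exact thinCE_cfgOf _ _ hx
  have hint (N : ℕ) := integral_congr_ae (hthin N)
  have hint2 (N : ℕ) := integral_congr_ae ((hthin N).mono fun x hx => congrArg (· ^ 2) hx)
  unfold PE
  simp_rw [hint, hint2]
  have h1 := hasSum_pois_mul_integral_thinSum a b c d p (k * n) (1 / k)
  have h2 := hasSum_pois_mul_integral_pairSum a b c d p (k * n) (1 / k) hq0.le hq
  set Φ := ∑' m, pois (1 / k * (k * n)) m * crossProb a b c d p m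
  have h3 := (h1.mul_left (1 / k : ℝ)).add (h2.mul_left (1 - 1 / k : ℝ))
  have hpois (N : ℕ) : 0 ≤ pois (k * n) N := by
    unfold pois
    positivity
  have hle (N : ℕ) : pois (k * n) N *
      ∫ x : Fin N → Pt, thinSum (1 / k) (subF a b c d x) ^ 2 ∂(Measure.pi fun _ => ptLaw p) ≤
      1 / k * (pois (k * n) N *
        ∫ x : Fin N → Pt, thinSum (1 / k) (subF a b c d x) ∂(Measure.pi fun _ => ptLaw p)) +
      (1 - 1 / k) * (pois (k * n) N *
        ∫ x : Fin N → Pt, pairSum (1 / k) (subF a b c d x) ∂(Measure.pi fun _ => ptLaw p)) := by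
    have h := integral_mono (integrable_thinSum_subF_sq a b c d p (N := N) (1 / k))
      (((integrable_thinSum_subF a b c d p (N := N) (1 / k)).const_mul (1 / k : ℝ)).add
        ((integrable_pairSum_subF a b c d p (N := N) (1 / k)).const_mul (1 - 1 / k : ℝ)))
      fun x => sq_thinSum_le k hk _ fun A => fR_mul_self a b c d _
    simp only [Pi.add_apply] at h
    rw [integral_add ((integrable_thinSum_subF a b c d p _).const_mul _)
      ((integrable_pairSum_subF a b c d p _).const_mul _), integral_const_mul,
      integral_const_mul] at h
    refine (mul_le_mul_of_nonneg_left h (hpois N)).trans_eq ?_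
    ring
  have hsum := Summable.of_nonneg_of_le
    (fun N => mul_nonneg (hpois N) (integral_nonneg fun _ => sq_nonneg _)) hle h3.summable
  have h4 := (hsum.tsum_le_tsum hle h3.summable).trans_eq h3.tsum_eq
  rw [h1.tsum_eq]
  nlinarith [mul_nonneg hq0.le (sq_nonneg (Φ - 1 / 2))]
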